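/- arXiv:1810.09346 — 2 statements merged into one kernel-verified Lean document; each statement's English description precedes it below -/
import Mathlib

section
/- Let K ≥ 2, let D be a distribution over [0,1]^K such that the marginal distribution of each coordinate is the same distribution supported on (0,1) with cumulative distribution function F, and define g(θ) = E[ε^{-2}·1{ε ≥ θ}] for ε drawn from this marginal. Fix any binary loss vectors ℓ_{i,t} ∈ {0,1}. In the variable-noise full-information model driven by D, run the EW-Threshold algorithm with any parameters θ ∈ (0,1) and η > 0 satisfying η ≤ 2θ. Then the regret satisfies Regret(T) ≤ (ln K)/η + η·T·g(θ) + F(θ)·T. Moreover, with η = √((ln K)/(T·g(θ))) (assuming this value satisfies η ≤ 2θ), Regret(T) ≤ 2·√(g(θ)·T·ln K) + F(θ)·T. -/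
open MeasureTheory

/-- Real value of a Boolean loss. -/
def b2r (b : Bool) : ℝ := if b then 1 else 0

theorem exp_neg_le_one_sub_add_sq {x : ℝ} (hx : -1 ≤ x) : Real.exp (-x) ≤ 1 - x + x ^ 2 := by
  rcases le_total x 1 with h | h
  · have := (abs_le.mp (Real.abs_exp_sub_one_sub_id_le (x := -x) (by rw [abs_neg]; exact abs_le.mpr ⟨hx, h⟩))).2
    nlinarith
  · have : Real.exp (-x) ≤ 1 := Real.exp_le_one_iff.mpr (by linarith)
    nlinarith

theorem exponential_weights_bound {ι : Type*} [Fintype ι] [Nonempty ι] {T : ℕ} {η : ℝ}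
    (hη : 0 < η) (x w : ι → ℕ → ℝ) (hx : ∀ i, ∀ t < T, -1 ≤ η * x i t) (hw0 : ∀ i, w i 0 = 1)
    (hw : ∀ i, ∀ t < T, w i (t + 1) = w i t * Real.exp (-η * x i t)) (k : ι) :
    ∑ t ∈ Finset.range T, ∑ i, w i t / (∑ j, w j t) * x i t ≤
      ∑ t ∈ Finset.range T, x k t + Real.log (Fintype.card ι) / η +
        η * ∑ t ∈ Finset.range T, ∑ i, w i t / (∑ j, w j t) * x i t ^ 2 := by
  set A : ℕ → ℝ := fun t => ∑ i, w i t / (∑ j, w j t) * x i t with hA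
  set B : ℕ → ℝ := fun t => ∑ i, w i t / (∑ j, w j t) * x i t ^ 2 with hB
  have closed : ∀ n ≤ T, ∀ i, w i n = Real.exp (-η * ∑ t ∈ Finset.range n, x i t) := by
    intro n
    induction n with
    | zero => intro _ i; simp [hw0]
    | succ n ih =>
      intro hn i
      rw [hw i n hn, ih (by omega) i, ← Real.exp_add, Finset.sum_range_succ]
      ring_nf
  have pos : ∀ n ≤ T, ∀ i, 0 < w i n := fun n hn i => by
    rw [closed n hn i]; exact Real.exp_pos _
  have total_pos : ∀ n ≤ T, 0 < ∑ j, w j n := fun n hn =>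
    Finset.sum_pos (fun i _ => pos n hn i) Finset.univ_nonempty
  have total_le : ∀ n ≤ T, Real.log (∑ j, w j n) ≤ Real.log (Fintype.card ι) +
      ∑ t ∈ Finset.range n, (-η * A t + η ^ 2 * B t) := by
    intro n
    induction n with
    | zero => intro _; simp [hw0]
    | succ n ih =>
      intro hn
      have hW := total_pos n (by omega)
      have step : ∑ j, w j (n + 1) ≤ (∑ j, w j n) * Real.exp (-η * A n + η ^ 2 * B n) := by
        calc ∑ j, w j (n + 1)
            ≤ ∑ j, w j n * (1 - η * x j n + (η * x j n) ^ 2) := by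
              refine Finset.sum_le_sum fun j _ => ?_
              rw [hw j n hn, neg_mul]
              exact mul_le_mul_of_nonneg_left (exp_neg_le_one_sub_add_sq (hx j n hn))
                (pos n (by omega) j).le
          _ = (∑ j, w j n) * (-η * A n + η ^ 2 * B n + 1) := by
              have h1 : (∑ j, w j n) * A n = ∑ j, w j n * x j n := by
                rw [hA, Finset.mul_sum]
                exact Finset.sum_congr rfl fun j _ => by field_simp
              have h2 : (∑ j, w j n) * B n = ∑ j, w j n * x j n ^ 2 := by
                rw [hB, Finset.mul_sum]
                exact Finset.sum_congr rfl fun j _ => by field_simp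
              have h3 : (∑ j, w j n) * (-η * A n + η ^ 2 * B n + 1) =
                  -η * ((∑ j, w j n) * A n) + η ^ 2 * ((∑ j, w j n) * B n) + ∑ j, w j n := by
                ring
              rw [h3, h1, h2, Finset.mul_sum, Finset.mul_sum, ← Finset.sum_add_distrib,
                ← Finset.sum_add_distrib]
              exact Finset.sum_congr rfl fun j _ => by ring
          _ ≤ _ := mul_le_mul_of_nonneg_left (Real.add_one_le_exp _) hW.le
      have hlog := Real.log_le_log (total_pos (n + 1) hn) step
      rw [Real.log_mul hW.ne' (Real.exp_pos _).ne', Real.log_exp] at hlog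
      rw [Finset.sum_range_succ]
      linarith [ih (by omega)]
  have lower : -η * ∑ t ∈ Finset.range T, x k t ≤ Real.log (∑ j, w j T) := by
    rw [← Real.log_exp (-η * _), ← closed T le_rfl k]
    exact Real.log_le_log (pos T le_rfl k)
      (Finset.single_le_sum (fun i _ => (pos T le_rfl i).le) (Finset.mem_univ k))
  have key := lower.trans (total_le T le_rfl)
  rw [Finset.sum_add_distrib, ← Finset.mul_sum, ← Finset.mul_sum] at key
  refine le_of_mul_le_mul_left ?_ hη
  have : η * (Real.log (Fintype.card ι) / η) = Real.log (Fintype.card ι) := by field_simp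
  rw [mul_add, mul_add, this]
  linarith

theorem exponential_weights_bound_fin {ι : Type*} [Fintype ι] [Nonempty ι] {T : ℕ} {η : ℝ}
    (hη : 0 < η) (x : ι → Fin T → ℝ) (w : ι → ℕ → ℝ) (hx : ∀ i t, -1 ≤ η * x i t)
    (hw0 : ∀ i, w i 0 = 1)
    (hw : ∀ i (t : Fin T), w i ((t : ℕ) + 1) = w i t * Real.exp (-η * x i t)) (k : ι) :
    ∑ t : Fin T, ∑ i, w i t / (∑ j, w j t) * x i t ≤
      ∑ t, x k t + Real.log (Fintype.card ι) / η +
        η * ∑ t : Fin T, ∑ i, w i t / (∑ j, w j t) * x i t ^ 2 := by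
  have := exponential_weights_bound hη (fun i n => if h : n < T then x i ⟨n, h⟩ else 0) w
    (fun i t ht => by rw [dif_pos ht]; exact hx i ⟨t, ht⟩) hw0
    (fun i t ht => by rw [dif_pos ht]; exact hw i ⟨t, ht⟩) k
  simpa only [Finset.sum_range, Fin.is_lt, dite_true, Fin.eta] using this

theorem integral_pi_mul_eval {ι X : Type*} [Fintype ι] [DecidableEq ι] [MeasurableSpace X]
    (P : Measure X) [IsProbabilityMeasure P] {f : (ι → X) → ℝ} {g : X → ℝ} (hf : Measurable f)
    (hg : Measurable g) (t : ι) (hft : ∀ ω x, f (Function.update ω t x) = f ω) :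
    ∫ ω, f ω * g (ω t) ∂(Measure.pi fun _ : ι => P) =
      (∫ ω, f ω ∂(Measure.pi fun _ : ι => P)) * ∫ x, g x ∂P := by
  obtain ⟨x₀⟩ : Nonempty X := P.nonempty_of_neZero
  have hind := (ProbabilityTheory.iIndepFun_pi (μ := fun _ : ι => P) (X := fun _ x => x)
    (fun _ => aemeasurable_id)).indepFun_finset {t}ᶜ {t} disjoint_compl_left
    (fun i => measurable_pi_apply i)
  let extend : (({t}ᶜ : Finset ι) → X) → ι → X :=
    fun a s => if h : s ∈ ({t}ᶜ : Finset ι) then a ⟨s, h⟩ else x₀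
  have hext : Measurable extend := by
    refine measurable_pi_lambda _ fun s => ?_
    by_cases h : s ∈ ({t}ᶜ : Finset ι)
    · simpa only [extend, h, dite_true] using measurable_pi_apply _
    · simp only [extend, h, dite_false, measurable_const]
  have hcomp := hind.comp (hf.comp hext)
    (hg.comp (measurable_pi_apply (⟨t, Finset.mem_singleton_self t⟩ : ({t} : Finset ι))))
  have hfe : (f ∘ extend) ∘ (fun a (i : ({t}ᶜ : Finset ι)) => a i) = f := by
    ext ω
    rw [← hft ω x₀]
    refine congrArg f (funext fun s => ?_)
    by_cases h : s = t
    · subst h; simp [extend]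
    · simp [extend, h]
  rw [hfe] at hcomp
  have := hcomp.integral_fun_mul_eq_mul_integral hf.aestronglyMeasurable
    (hg.comp (measurable_pi_apply t)).aestronglyMeasurable
  refine this.trans (congrArg _ ?_)
  exact integral_comp_eval (μ := fun _ : ι => P) hg.aestronglyMeasurable

theorem exponential_weights_pos {T : ℕ} {η : ℝ} {x : Fin T → ℝ} {w : ℕ → ℝ} (hw0 : w 0 = 1)
    (hw : ∀ t : Fin T, w ((t : ℕ) + 1) = w t * Real.exp (-η * x t)) : ∀ n ≤ T, 0 < w n := by
  intro n
  induction n with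
  | zero => intro _; simp [hw0]
  | succ n ih =>
    intro hn
    rw [hw ⟨n, hn⟩]
    exact mul_pos (ih (by omega)) (Real.exp_pos _)

theorem integral_exponential_weights_bound {ι X : Type*} [Fintype ι] [Nonempty ι]
    [MeasurableSpace X] (P : Measure X) [IsProbabilityMeasure P] {T : ℕ} {η ρ G C : ℝ}
    (hη : 0 < η) (L : ι → Fin T → X → ℝ) (hLmeas : ∀ i t, Measurable (L i t))
    (hLbound : ∀ i t x, |L i t x| ≤ C) (hLlower : ∀ i t x, -1 ≤ η * L i t x)
    (a : ι → Fin T → ℝ) (hmean : ∀ i t, ∫ x, L i t x ∂P = ρ * a i t)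
    (hsq : ∀ i t, ∫ x, L i t x ^ 2 ∂P ≤ G)
    (w : (Fin T → X) → ι → ℕ → ℝ) (hw0 : ∀ ω i, w ω i 0 = 1)
    (hw : ∀ ω i (t : Fin T),
      w ω i ((t : ℕ) + 1) = w ω i t * Real.exp (-η * L i t (ω t))) (k : ι) :
    ρ * ((∫ ω, ∑ t : Fin T, ∑ i, w ω i t / (∑ j, w ω j t) * a i t
        ∂(Measure.pi fun _ : Fin T => P)) - ∑ t, a k t) ≤
      Real.log (Fintype.card ι) / η + η * T * G := by
  set μ : Measure (Fin T → X) := Measure.pi fun _ : Fin T => P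
  have wpos : ∀ n ≤ T, ∀ ω i, 0 < w ω i n := fun n hn ω i =>
    exponential_weights_pos (x := fun t => L i t (ω t)) (hw0 ω i) (hw ω i) n hn
  have wmeas : ∀ n ≤ T, ∀ i, Measurable fun ω => w ω i n := by
    intro n
    induction n with
    | zero => intro _ i; simp [hw0]
    | succ n ih =>
      intro hn i
      simp only [fun ω => hw ω i ⟨n, hn⟩]
      exact (ih (by omega) i).mul (Real.measurable_exp.comp
        (((hLmeas i ⟨n, hn⟩).comp (measurable_pi_apply _)).const_mul _))
  have wupdate : ∀ (t : Fin T) (n : ℕ), n ≤ t → ∀ ω x i,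
      w (Function.update ω t x) i n = w ω i n := by
    intro t n
    induction n with
    | zero => intro _ ω x i; simp [hw0]
    | succ n ih =>
      intro hn ω x i
      have hnT : n < T := by omega
      have hne : (⟨n, hnT⟩ : Fin T) ≠ t := by
        rintro rfl; simp at hn
      have h1 := hw (Function.update ω t x) i ⟨n, hnT⟩
      have h2 := hw ω i ⟨n, hnT⟩
      simp only at h1 h2
      rw [h1, h2, ih (by omega), Function.update_of_ne hne]
  set q : ι → Fin T → (Fin T → X) → ℝ := fun i t ω => w ω i t / ∑ j, w ω j t with hq
  have qsum : ∀ t ω, ∑ i, q i t ω = 1 := fun t ω => by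
    rw [hq, ← Finset.sum_div]
    exact div_self (Finset.sum_pos (fun i _ => wpos t t.2.le ω i) Finset.univ_nonempty).ne'
  have qnonneg : ∀ i t ω, 0 ≤ q i t ω := fun i t ω =>
    div_nonneg (wpos t t.2.le ω i).le (Finset.sum_nonneg fun j _ => (wpos t t.2.le ω j).le)
  have qle : ∀ i t ω, q i t ω ≤ 1 := fun i t ω => by
    rw [← qsum t ω]
    exact Finset.single_le_sum (fun j _ => qnonneg j t ω) (Finset.mem_univ i)
  have qmeas : ∀ i t, Measurable (q i t) := fun i t =>
    (wmeas t t.2.le i).div (Finset.measurable_sum _ fun j _ => wmeas t t.2.le j)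
  have qupdate : ∀ i t ω x, q i t (Function.update ω t x) = q i t ω := fun i t ω x => by
    simp only [hq, wupdate t t le_rfl]
  have qint : ∀ i t, Integrable (q i t) μ := fun i t =>
    Integrable.of_bound (qmeas i t).aestronglyMeasurable 1
      (Filter.Eventually.of_forall fun ω => by
        rw [Real.norm_of_nonneg (qnonneg i t ω)]; exact qle i t ω)
  have L2bound : ∀ i t x, |L i t x ^ 2| ≤ C ^ 2 := fun i t x => by
    rw [abs_pow]; exact pow_le_pow_left₀ (abs_nonneg _) (hLbound i t x) 2
  have evalint : ∀ (f : X → ℝ) (B : ℝ), Measurable f → (∀ x, |f x| ≤ B) → ∀ t : Fin T,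
      Integrable (fun ω => f (ω t)) μ := fun f B hf hB t =>
    Integrable.of_bound (hf.comp (measurable_pi_apply t)).aestronglyMeasurable B
      (Filter.Eventually.of_forall fun ω => hB (ω t))
  have mulint : ∀ (f : X → ℝ) (B : ℝ), Measurable f → (∀ x, |f x| ≤ B) → ∀ i (t : Fin T),
      Integrable (fun ω => q i t ω * f (ω t)) μ := fun f B hf hB i t =>
    Integrable.bdd_mul (c := 1) (evalint f B hf hB t) (qmeas i t).aestronglyMeasurable
      (Filter.Eventually.of_forall fun ω => by
        rw [Real.norm_of_nonneg (qnonneg i t ω)]; exact qle i t ω)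
  have int1 : ∀ i (t : Fin T), Integrable (fun ω => q i t ω * L i t (ω t)) μ := fun i t =>
    mulint _ C (hLmeas i t) (hLbound i t) i t
  have int2 : ∀ i (t : Fin T), Integrable (fun ω => q i t ω * L i t (ω t) ^ 2) μ := fun i t =>
    mulint (fun x => L i t x ^ 2) _ ((hLmeas i t).pow_const 2) (L2bound i t) i t
  have intk : ∀ t : Fin T, Integrable (fun ω => L k t (ω t)) μ := fun t =>
    evalint _ C (hLmeas k t) (hLbound k t) t
  have int1s : Integrable (fun ω => ∑ t, ∑ i, q i t ω * L i t (ω t)) μ :=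
    integrable_finsetSum _ fun t _ => integrable_finsetSum _ fun i _ => int1 i t
  have int2s : Integrable (fun ω => ∑ t, ∑ i, q i t ω * L i t (ω t) ^ 2) μ :=
    integrable_finsetSum _ fun t _ => integrable_finsetSum _ fun i _ => int2 i t
  have intks : Integrable (fun ω => ∑ t, L k t (ω t)) μ :=
    integrable_finsetSum _ fun t _ => intk t
  have lhs_eq : ∫ ω, ∑ t, ∑ i, q i t ω * L i t (ω t) ∂μ =
      ρ * ∫ ω, ∑ t, ∑ i, q i t ω * a i t ∂μ := by
    rw [integral_finsetSum _ fun t _ => integrable_finsetSum _ fun i _ => int1 i t,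
      integral_finsetSum _ fun t _ =>
        integrable_finsetSum _ fun i _ => (qint i t).mul_const (a i t),
      Finset.mul_sum]
    refine Finset.sum_congr rfl fun t _ => ?_
    rw [integral_finsetSum _ fun i _ => int1 i t,
      integral_finsetSum _ fun i _ => (qint i t).mul_const (a i t), Finset.mul_sum]
    refine Finset.sum_congr rfl fun i _ => ?_
    rw [integral_pi_mul_eval P (qmeas i t) (hLmeas i t) t (qupdate i t), hmean,
      integral_mul_const]
    ring
  have sq_le : ∫ ω, ∑ t, ∑ i, q i t ω * L i t (ω t) ^ 2 ∂μ ≤ T * G := by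
    rw [integral_finsetSum _ fun t _ => integrable_finsetSum _ fun i _ => int2 i t]
    calc ∑ t, ∫ ω, ∑ i, q i t ω * L i t (ω t) ^ 2 ∂μ ≤ ∑ _t : Fin T, G := by
          refine Finset.sum_le_sum fun t _ => ?_
          rw [integral_finsetSum _ fun i _ => int2 i t]
          calc ∑ i, ∫ ω, q i t ω * L i t (ω t) ^ 2 ∂μ ≤ ∑ i, (∫ ω, q i t ω ∂μ) * G := by
                refine Finset.sum_le_sum fun i _ => ?_
                rw [integral_pi_mul_eval P (g := fun x => L i t x ^ 2) (qmeas i t)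
                  ((hLmeas i t).pow_const 2) t (qupdate i t)]
                exact mul_le_mul_of_nonneg_left (hsq i t) (integral_nonneg (qnonneg i t))
            _ = G := by
                rw [← Finset.sum_mul, ← integral_finsetSum _ fun i _ => qint i t]
                simp [qsum]
      _ = T * G := by simp
  have k_eq : ∫ ω, ∑ t, L k t (ω t) ∂μ = ρ * ∑ t, a k t := by
    rw [integral_finsetSum _ fun t _ => intk t, Finset.mul_sum]
    refine Finset.sum_congr rfl fun t _ => ?_
    rw [← hmean]
    exact integral_comp_eval (μ := fun _ : Fin T => P) (hLmeas k t).aestronglyMeasurable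
  have intA : Integrable
      (fun ω => ∑ t, L k t (ω t) + Real.log (Fintype.card ι) / η) μ :=
    intks.add (integrable_const _)
  have key := integral_mono int1s (intA.add (int2s.const_mul η))
    fun ω => exponential_weights_bound_fin hη (fun i t => L i t (ω t)) (w ω)
      (fun i t => hLlower i t (ω t)) (hw0 ω) (hw ω) k
  rw [integral_add' intA (int2s.const_mul η), integral_add intks (integrable_const _),
    lhs_eq, k_eq, integral_const_mul] at key
  simp only [integral_const, probReal_univ, one_smul] at key
  have := mul_le_mul_of_nonneg_left sq_le hη.le
  rw [mul_sub]
  linarith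

/-- The thresholded unbiased loss estimate from a noise parameter `e` and a uniform seed `u`
when the true loss is `l`. -/
noncomputable def lossEstimate (θ : ℝ) (l : Bool) (e u : ℝ) : ℝ :=
  (b2r (Bool.xor l (decide (u < (1 - e) / 2))) - (1 - e) / 2) / (1 - 2 * ((1 - e) / 2)) *
    (if θ ≤ e then 1 else 0)

theorem b2r_nonneg (b : Bool) : 0 ≤ b2r b := by cases b <;> simp [b2r]

theorem b2r_le_one (b : Bool) : b2r b ≤ 1 := by cases b <;> simp [b2r]

theorem lossEstimate_eq (θ : ℝ) (l : Bool) (e u : ℝ) :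
    lossEstimate θ l e u =
      ((b2r l + (1 - 2 * b2r l) * (Set.Iio ((1 - e) / 2)).indicator 1 u - (1 - e) / 2) / e) *
        (if θ ≤ e then 1 else 0) := by
  unfold lossEstimate
  have h : 1 - 2 * ((1 - e) / 2) = e := by ring
  rw [h]
  by_cases hu : u < (1 - e) / 2 <;> cases l <;> simp [b2r, hu]
  norm_num

theorem measurable_lossEstimate (θ : ℝ) (l : Bool) :
    Measurable fun z : ℝ × ℝ => lossEstimate θ l z.1 z.2 := by
  have hind : Measurable fun z : ℝ × ℝ =>
      b2r (Bool.xor l (decide (z.2 < (1 - z.1) / 2))) := by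
    have h : (fun z : ℝ × ℝ => b2r (Bool.xor l (decide (z.2 < (1 - z.1) / 2)))) =
        fun z => if z.2 < (1 - z.1) / 2 then b2r (!l) else b2r l := by
      ext z
      by_cases hz : z.2 < (1 - z.1) / 2 <;> simp [hz]
    rw [h]
    exact Measurable.ite (measurableSet_lt (by fun_prop) (by fun_prop)) measurable_const
      measurable_const
  have hthr : Measurable fun z : ℝ × ℝ => if θ ≤ z.1 then (1 : ℝ) else 0 :=
    Measurable.ite (measurableSet_le measurable_const measurable_fst) measurable_const
      measurable_const
  exact ((hind.sub (by fun_prop)).div (by fun_prop)).mul hthr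

theorem abs_lossEstimate_le {θ : ℝ} (hθ : 0 < θ) (l : Bool) (e u : ℝ) :
    |lossEstimate θ l e u| ≤ 1 / (2 * θ) + 1 / 2 := by
  have hC : 0 < 1 / (2 * θ) + 1 / 2 := by positivity
  unfold lossEstimate
  split_ifs with h
  · have he : 0 < e := hθ.trans_le h
    have hinv : 1 / (2 * e) ≤ 1 / (2 * θ) := by gcongr
    have hinv' : 0 < 1 / (2 * e) := by positivity
    set b := Bool.xor l (decide (u < (1 - e) / 2))
    have hrw : (b2r b - (1 - e) / 2) / (1 - 2 * ((1 - e) / 2)) * 1 =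
        (2 * b2r b - 1) * (1 / (2 * e)) + 1 / 2 := by
      have : 1 - 2 * ((1 - e) / 2) = e := by ring
      rw [this]; field_simp; ring
    rw [hrw, abs_le]
    constructor <;> nlinarith [b2r_nonneg b, b2r_le_one b]
  · simpa using hC.le

theorem neg_one_le_mul_lossEstimate {θ η : ℝ} (hη : 0 < η) (hηθ : η ≤ 2 * θ) (l : Bool)
    (e u : ℝ) : -1 ≤ η * lossEstimate θ l e u := by
  unfold lossEstimate
  split_ifs with h
  · have he : 0 < e := by linarith
    have h2 : 1 - 2 * ((1 - e) / 2) = e := by ring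
    rw [h2, mul_one, mul_div_assoc', le_div_iff₀ he]
    nlinarith [b2r_nonneg (Bool.xor l (decide (u < (1 - e) / 2)))]
  · simp

theorem lossEstimate_sq_le {e : ℝ} (he : e ∈ Set.Ioo (0 : ℝ) 1) (θ : ℝ) (l : Bool) (u : ℝ) :
    lossEstimate θ l e u ^ 2 ≤ if θ ≤ e then (e ^ 2)⁻¹ else 0 := by
  unfold lossEstimate
  split_ifs with h
  · have h2 : 1 - 2 * ((1 - e) / 2) = e := by ring
    rw [h2, mul_one, div_pow, div_eq_mul_inv]
    refine mul_le_of_le_one_left (by positivity) ?_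
    rw [sq_le_one_iff_abs_le_one, abs_le]
    have h0 := b2r_nonneg (Bool.xor l (decide (u < (1 - e) / 2)))
    have h1 := b2r_le_one (Bool.xor l (decide (u < (1 - e) / 2)))
    constructor <;> linarith [he.1, he.2]
  · simp

theorem integral_lossEstimate {e : ℝ} (he : e ∈ Set.Ioo (0 : ℝ) 1) (θ : ℝ) (l : Bool) :
    ∫ u in Set.Icc (0 : ℝ) 1, lossEstimate θ l e u = (if θ ≤ e then 1 else 0) * b2r l := by
  have hp : ∫ u in Set.Icc (0 : ℝ) 1, (Set.Iio ((1 - e) / 2)).indicator (1 : ℝ → ℝ) u =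
      (1 - e) / 2 := by
    rw [integral_indicator_one measurableSet_Iio, measureReal_restrict_apply measurableSet_Iio]
    have : Set.Iio ((1 - e) / 2) ∩ Set.Icc 0 1 = Set.Ico 0 ((1 - e) / 2) := by
      ext u
      simp only [Set.mem_inter_iff, Set.mem_Iio, Set.mem_Icc, Set.mem_Ico]
      constructor
      · rintro ⟨h1, h2, _⟩; exact ⟨h2, h1⟩
      · rintro ⟨h1, h2⟩; exact ⟨h2, h1, by linarith [he.1]⟩
    rw [this, Real.volume_real_Ico_of_le (by linarith [he.2])]
    ring
  have hind_int : Integrable ((Set.Iio ((1 - e) / 2)).indicator (1 : ℝ → ℝ))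
      (volume.restrict (Set.Icc (0 : ℝ) 1)) :=
    (integrable_const (1 : ℝ)).indicator measurableSet_Iio
  simp only [lossEstimate_eq]
  have hfull : Integrable (fun u => b2r l + (1 - 2 * b2r l) *
      (Set.Iio ((1 - e) / 2)).indicator 1 u) (volume.restrict (Set.Icc (0 : ℝ) 1)) :=
    (integrable_const _).add (hind_int.const_mul _)
  rw [integral_mul_const, integral_div, integral_sub hfull (integrable_const _),
    integral_add (integrable_const _) (hind_int.const_mul _), integral_const_mul, hp]
  simp only [integral_const, measureReal_restrict_apply_univ, Real.volume_real_Icc]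
  have := he.1.ne'
  norm_num
  split_ifs
  · field_simp; ring
  · simp

instance isProbabilityMeasure_restrict_Icc_zero_one :
    IsProbabilityMeasure ((volume : Measure ℝ).restrict (Set.Icc 0 1)) :=
  ⟨by simp⟩

theorem integral_prod_lossEstimate (m : Measure ℝ) [IsProbabilityMeasure m]
    (hsupp : m (Set.Ioo (0 : ℝ) 1)ᶜ = 0) {θ : ℝ} (hθ : 0 < θ) (l : Bool) :
    ∫ z, lossEstimate θ l z.1 z.2 ∂(m.prod (volume.restrict (Set.Icc 0 1))) =
      m.real (Set.Ici θ) * b2r l := by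
  rw [integral_prod _ (Integrable.of_bound (measurable_lossEstimate θ l).aestronglyMeasurable _
    (Filter.Eventually.of_forall fun z => abs_lossEstimate_le hθ l z.1 z.2))]
  have hae : ∀ᵐ e ∂m, ∫ u in Set.Icc (0 : ℝ) 1, lossEstimate θ l e u =
      (Set.Ici θ).indicator 1 e * b2r l := by
    filter_upwards [mem_ae_iff.mpr hsupp] with e he
    rw [integral_lossEstimate he]
    simp [Set.indicator_apply]
  rw [integral_congr_ae hae, integral_mul_const, integral_indicator_one measurableSet_Ici]

theorem integral_prod_lossEstimate_sq_le (m : Measure ℝ) [IsProbabilityMeasure m]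
    (hsupp : m (Set.Ioo (0 : ℝ) 1)ᶜ = 0) {θ : ℝ} (hθ : 0 < θ) (l : Bool) :
    ∫ z, lossEstimate θ l z.1 z.2 ^ 2 ∂(m.prod (volume.restrict (Set.Icc 0 1))) ≤
      ∫ e, (if θ ≤ e then (e ^ 2)⁻¹ else 0) ∂m := by
  have hmeas : Measurable fun e : ℝ => if θ ≤ e then (e ^ 2)⁻¹ else 0 :=
    Measurable.ite measurableSet_Ici (by fun_prop) measurable_const
  have hind_int : Integrable (fun e : ℝ => if θ ≤ e then (e ^ 2)⁻¹ else 0) m := by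
    refine Integrable.of_bound hmeas.aestronglyMeasurable (θ ^ 2)⁻¹
      (Filter.Eventually.of_forall fun e => ?_)
    split_ifs with h
    · rw [Real.norm_of_nonneg (by positivity)]
      gcongr
    · simp; positivity
  have hfst := integral_fun_fst (μ := m) (ν := volume.restrict (Set.Icc (0 : ℝ) 1))
    (fun e : ℝ => if θ ≤ e then (e ^ 2)⁻¹ else 0)
  rw [probReal_univ, one_smul] at hfst
  rw [← hfst]
  refine integral_mono_ae ?_ (hind_int.comp_fst _) ?_
  · refine Integrable.of_bound ((measurable_lossEstimate θ l).pow_const 2).aestronglyMeasurable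
      ((1 / (2 * θ) + 1 / 2) ^ 2) (Filter.Eventually.of_forall fun z => ?_)
    rw [norm_pow]
    exact pow_le_pow_left₀ (norm_nonneg _) (abs_lossEstimate_le hθ l z.1 z.2) 2
  · filter_upwards [Measure.quasiMeasurePreserving_fst.ae (mem_ae_iff.mpr hsupp)] with z hz
    exact lossEstimate_sq_le hz θ l z.2

theorem tuned_rate_eq {a S γ η : ℝ} (ha : 0 < a) (hη : 0 < η)
    (hη_eq : η = Real.sqrt (a / (S * γ))) :
    a / η + η * S * γ = 2 * Real.sqrt (γ * S * a) := by
  have hquot : 0 < a / (S * γ) := Real.sqrt_pos.mp (hη_eq ▸ hη)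
  have hSγ : 0 < S * γ := (div_pos_iff_of_pos_left ha).mp hquot
  have hηsq : η ^ 2 * (S * γ) = a := by
    rw [hη_eq, Real.sq_sqrt hquot.le]
    exact div_mul_cancel₀ _ hSγ.ne'
  have hroot : Real.sqrt (γ * S * a) = η * (S * γ) := by
    rw [← hηsq, ← Real.sqrt_sq (mul_pos hη hSγ).le]
    congr 1
    ring
  have hdiv : a / η = η * (S * γ) := by
    rw [← hηsq]
    field_simp
  rw [hroot, hdiv]
  ring

set_option maxHeartbeats 1000000 in
/-- EW-Threshold with a general noise distribution `D` whose coordinate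
marginals all equal a measure `m` supported on `(0,1)`, with CDF `F` and
`g θ = E[ε⁻² · 1{ε ≥ θ}]`.  Sample space as in the uniform case: `ω.1 t` is the noise
vector drawn from `D` and `ω.2 t i` is a uniform seed generating the Bernoulli(p_{i,t})
noise bit. -/
theorem ew_threshold_general (K T : ℕ) (hK : 2 ≤ K)
    (D : Measure (Fin K → ℝ)) (hDprob : IsProbabilityMeasure D)
    (m : Measure ℝ) (hDmarg : ∀ i : Fin K, D.map (fun v => v i) = m)
    (hsupp : m (Set.Ioo (0 : ℝ) 1)ᶜ = 0)
    (F g : ℝ → ℝ)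
    (hF : ∀ x, F x = (m (Set.Iic x)).toReal)
    (hg : ∀ x, g x = ∫ e, (if x ≤ e then (e ^ 2)⁻¹ else 0) ∂m)
    (θ η : ℝ) (hθ : θ ∈ Set.Ioo (0 : ℝ) 1) (hη : 0 < η) (hηθ : η ≤ 2 * θ)
    (ℓ : Fin K → Fin T → Bool)
    (c : Fin K → Fin T → ((Fin T → Fin K → ℝ) × (Fin T → Fin K → ℝ)) → Bool)
    (hc : ∀ i t ω, c i t ω = Bool.xor (ℓ i t) (decide (ω.2 t i < (1 - ω.1 t i) / 2)))
    (lhat : ((Fin T → Fin K → ℝ) × (Fin T → Fin K → ℝ)) → Fin K → Fin T → ℝ)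
    (hlhat : ∀ ω i t, lhat ω i t =
      (b2r (c i t ω) - (1 - ω.1 t i) / 2) / (1 - 2 * ((1 - ω.1 t i) / 2)) *
        (if θ ≤ ω.1 t i then 1 else 0))
    (w : ((Fin T → Fin K → ℝ) × (Fin T → Fin K → ℝ)) → Fin K → ℕ → ℝ)
    (q : ((Fin T → Fin K → ℝ) × (Fin T → Fin K → ℝ)) → Fin K → Fin T → ℝ)
    (hw0 : ∀ ω i, w ω i 0 = 1)
    (hw : ∀ ω i (t : Fin T), w ω i ((t : ℕ) + 1) = w ω i t * Real.exp (-η * lhat ω i t))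
    (hq : ∀ ω i t, q ω i t = w ω i t / ∑ j, w ω j t) :
    ((∫ ω, (∑ t, ∑ i, q ω i t * b2r (ℓ i t))
        ∂((Measure.pi fun _ : Fin T => D).prod
            (Measure.pi fun _ : Fin T => Measure.pi fun _ : Fin K =>
              volume.restrict (Set.Icc 0 1))))
      - Finset.univ.inf' (Finset.univ_nonempty_iff.mpr ⟨⟨0, by omega⟩⟩)
          (fun k => ∑ t, b2r (ℓ k t))
      ≤ Real.log K / η + η * T * g θ + F θ * T) ∧
    (η = Real.sqrt (Real.log K / (T * g θ)) →
      (∫ ω, (∑ t, ∑ i, q ω i t * b2r (ℓ i t))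
          ∂((Measure.pi fun _ : Fin T => D).prod
              (Measure.pi fun _ : Fin T => Measure.pi fun _ : Fin K =>
                volume.restrict (Set.Icc 0 1))))
        - Finset.univ.inf' (Finset.univ_nonempty_iff.mpr ⟨⟨0, by omega⟩⟩)
            (fun k => ∑ t, b2r (ℓ k t))
        ≤ 2 * Real.sqrt (g θ * T * Real.log K) + F θ * T) := by
  have : Nonempty (Fin K) := ⟨⟨0, by omega⟩⟩
  have hm : ∀ i : Fin K, MeasurePreserving (fun v : Fin K → ℝ => v i) D m := fun i =>
    ⟨measurable_pi_apply i, hDmarg i⟩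
  have : IsProbabilityMeasure m := hDmarg ⟨0, by omega⟩ ▸
    Measure.isProbabilityMeasure_map (measurable_pi_apply _).aemeasurable
  set U : Measure ℝ := volume.restrict (Set.Icc 0 1) with hU
  set P : Measure ((Fin K → ℝ) × (Fin K → ℝ)) := D.prod (Measure.pi fun _ : Fin K => U)
  have hcoord : ∀ i : Fin K, MeasurePreserving
      (fun z : (Fin K → ℝ) × (Fin K → ℝ) => (z.1 i, z.2 i)) P (m.prod U) := fun i =>
    (hm i).prod (measurePreserving_eval (fun _ : Fin K => U) i)
  have hlhat' : ∀ ω i t, lhat ω i t = lossEstimate θ (ℓ i t) (ω.1 t i) (ω.2 t i) :=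
    fun ω i t => by rw [hlhat, hc]; rfl
  have hmeas := fun l => measurable_lossEstimate θ l
  have hmeasP : ∀ l (i : Fin K), Measurable fun x : (Fin K → ℝ) × (Fin K → ℝ) =>
      lossEstimate θ l (x.1 i) (x.2 i) := fun l i =>
    Measurable.comp (g := fun z : ℝ × ℝ => lossEstimate θ l z.1 z.2) (hmeas l)
      (hcoord i).measurable
  have hmean : ∀ i t, ∫ x, lossEstimate θ (ℓ i t) (x.1 i) (x.2 i) ∂P =
      m.real (Set.Ici θ) * b2r (ℓ i t) := fun i t => by
    rw [← integral_prod_lossEstimate m hsupp hθ.1 (ℓ i t), ← hU, ← (hcoord i).map_eq,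
      integral_map (hcoord i).aemeasurable (hmeas _).aestronglyMeasurable]
  have hsq : ∀ i t, ∫ x, lossEstimate θ (ℓ i t) (x.1 i) (x.2 i) ^ 2 ∂P ≤ g θ := fun i t => by
    rw [hg]
    refine le_trans (le_of_eq ?_) (integral_prod_lossEstimate_sq_le m hsupp hθ.1 (ℓ i t))
    rw [← hU, ← (hcoord i).map_eq, integral_map (hcoord i).aemeasurable
      ((hmeas _).pow_const 2).aestronglyMeasurable]
  have wpos : ∀ ω i (t : Fin T), 0 < w ω i t := fun ω i t =>
    exponential_weights_pos (hw0 ω i) (hw ω i) t t.2.le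
  set ν : Measure ((Fin T → Fin K → ℝ) × (Fin T → Fin K → ℝ)) :=
    (Measure.pi fun _ : Fin T => D).prod
      (Measure.pi fun _ : Fin T => Measure.pi fun _ : Fin K => U)
  have hν := measurePreserving_arrowProdEquivProdArrow (Fin K → ℝ) (Fin K → ℝ) (Fin T)
    (fun _ => D) (fun _ => Measure.pi fun _ : Fin K => U)
  set I : ℝ := ∫ ω, (∑ t, ∑ i, q ω i t * b2r (ℓ i t)) ∂ν with hI
  have hI_le : I ≤ T := by
    refine (Real.le_norm_self _).trans ((norm_integral_le_of_norm_le_const (C := T)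
      (Filter.Eventually.of_forall fun ω => ?_)).trans (by simp))
    have hqnonneg : ∀ i t, 0 ≤ q ω i t := fun i t => by
      rw [hq]
      exact div_nonneg (wpos ω i t).le (Finset.sum_nonneg fun j _ => (wpos ω j t).le)
    rw [Real.norm_of_nonneg (Finset.sum_nonneg fun t _ => Finset.sum_nonneg fun i _ =>
      mul_nonneg (hqnonneg i t) (b2r_nonneg _))]
    calc ∑ t, ∑ i, q ω i t * b2r (ℓ i t) ≤ ∑ t, ∑ i, q ω i t :=
          Finset.sum_le_sum fun t _ => Finset.sum_le_sum fun i _ =>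
            mul_le_of_le_one_right (hqnonneg i t) (b2r_le_one _)
      _ = ∑ _t : Fin T, (1 : ℝ) := by
          refine Finset.sum_congr rfl fun t _ => ?_
          simp only [hq]
          rw [← Finset.sum_div]
          exact div_self (Finset.sum_pos (fun i _ => wpos ω i t) Finset.univ_nonempty).ne'
      _ = T := by simp
  have hscaled : ∀ k, m.real (Set.Ici θ) * (I - ∑ t, b2r (ℓ k t)) ≤
      Real.log K / η + η * T * g θ := by
    intro k
    have hmain := integral_exponential_weights_bound P hη
      (L := fun i t x => lossEstimate θ (ℓ i t) (x.1 i) (x.2 i))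
      (ρ := m.real (Set.Ici θ)) (G := g θ)
      (fun i t => hmeasP (ℓ i t) i)
      (fun i t x => abs_lossEstimate_le hθ.1 (ℓ i t) (x.1 i) (x.2 i))
      (fun i t x => neg_one_le_mul_lossEstimate hη hηθ (ℓ i t) (x.1 i) (x.2 i))
      (fun i t => b2r (ℓ i t)) hmean hsq
      (fun ω => w (MeasurableEquiv.arrowProdEquivProdArrow _ _ _ ω))
      (fun ω => hw0 _)
      (fun ω i t => (hw _ i t).trans (by rw [hlhat']; rfl)) k
    rw [Fintype.card_fin] at hmain
    rw [hI, ← hν.integral_comp']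
    simpa only [hq] using hmain
  obtain ⟨k, -, hk⟩ := Finset.exists_mem_eq_inf'
    (Finset.univ_nonempty_iff.mpr ⟨⟨0, by omega⟩⟩ : (Finset.univ : Finset (Fin K)).Nonempty)
    (fun k => ∑ t, b2r (ℓ k t))
  rw [hk]
  have hregret : I - ∑ t, b2r (ℓ k t) ≤ Real.log K / η + η * T * g θ + F θ * T := by
    have hle : I - ∑ t, b2r (ℓ k t) ≤ T := by
      linarith [Finset.sum_nonneg fun t (_ : t ∈ Finset.univ) => b2r_nonneg (ℓ k t)]
    have hcompl : 1 - m.real (Set.Ici θ) = m.real (Set.Iio θ) := by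
      rw [← Set.compl_Ici, probReal_compl_eq_one_sub measurableSet_Ici]
    have hF_le : m.real (Set.Iio θ) ≤ F θ := by
      rw [hF]
      exact measureReal_mono Set.Iio_subset_Iic_self
    have h1 := mul_le_mul_of_nonneg_left hle (measureReal_nonneg (μ := m) (s := Set.Iio θ))
    have h2 := mul_le_mul_of_nonneg_right hF_le (Nat.cast_nonneg (α := ℝ) T)
    have h3 := hscaled k
    rw [← hcompl] at h1 h2
    linarith
  refine ⟨hregret, fun hη_eq => hregret.trans (add_le_add_left (le_of_eq ?_) _)⟩
  exact tuned_rate_eq (Real.log_pos (by exact_mod_cast hK)) hη hη_eq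
end

section
/- Consider the variable-noise full-information model with K = 2 actions, where at each round t the noise parameters ε_{1,t}, ε_{2,t} are i.i.d. uniform on [0,1] (independently across rounds) and the learner does NOT observe the noise parameters: its action distribution at round t is a function only of the noisy feedbacks of rounds 1,…,t-1. Then for every such learning algorithm there exists a strategy for assigning binary losses (possibly depending on the realized noise parameters) under which the expected regret satisfies Regret(T) ≥ T/8. -/
open MeasureTheory

/-- Uniform measure on `[0,1]`. -/
noncomputable def uniform01 : Measure ℝ := volume.restrict (Set.Icc 0 1)

instance isProbabilityMeasure_uniform01 : IsProbabilityMeasure uniform01 :=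
  ⟨by simp [uniform01]⟩

theorem integral_uniform01_ite_lt {a : ℝ} (h0 : 0 ≤ a) (h1 : a ≤ 1) {f g : ℝ → ℝ}
    (hf : Continuous f) (hg : Continuous g) :
    ∫ x, (if x < a then f x else g x) ∂uniform01 = (∫ x in 0..a, f x) + ∫ x in a..1, g x := by
  have hI : IntervalIntegrable (fun x => if x < a then f x else g x) volume 0 a := by
    refine (hf.intervalIntegrable 0 a).congr_ae ?_
    rw [Set.uIoc_of_le h0]
    have : ∀ᵐ x : ℝ, x ≠ a := by simp [ae_iff]
    filter_upwards [ae_restrict_of_ae this, ae_restrict_mem measurableSet_Ioc] with x hx hm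
    rw [if_pos (lt_of_le_of_ne hm.2 hx)]
  have hJ : IntervalIntegrable (fun x => if x < a then f x else g x) volume a 1 := by
    refine (hg.intervalIntegrable a 1).congr_ae ?_
    rw [Set.uIoc_of_le h1]
    filter_upwards [ae_restrict_mem measurableSet_Ioc] with x hm
    rw [if_neg hm.1.le.not_gt]
  rw [uniform01, integral_Icc_eq_integral_Ioc, ← intervalIntegral.integral_of_le zero_le_one,
    ← intervalIntegral.integral_add_adjacent_intervals hI hJ]
  congr 1
  · refine intervalIntegral.integral_congr_ae ?_
    have : ∀ᵐ x : ℝ, x ≠ a := by simp [ae_iff]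
    filter_upwards [this] with x hx hm
    rw [Set.uIoc_of_le h0] at hm
    rw [if_pos (lt_of_le_of_ne hm.2 hx)]
  · refine intervalIntegral.integral_congr_ae (.of_forall fun x hm => ?_)
    rw [Set.uIoc_of_le h1] at hm
    rw [if_neg hm.1.le.not_gt]

/-- The integral of a product of functions of distinct coordinate pairs factorizes. -/
theorem integral_prod_pi_pi_prod {ι κ : Type*} [Fintype ι] [Fintype κ] (ν : Measure ℝ)
    [IsProbabilityMeasure ν] (φ : ι → κ → ℝ → ℝ → ℝ)
    (hm : ∀ s j, Measurable fun p : ℝ × ℝ => φ s j p.1 p.2)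
    (hb : ∀ s j x y, |φ s j x y| ≤ 1) :
    Integrable (fun ω : (ι → κ → ℝ) × (ι → κ → ℝ) => ∏ s, ∏ j, φ s j (ω.1 s j) (ω.2 s j))
      ((Measure.pi fun _ => Measure.pi fun _ => ν).prod
        (Measure.pi fun _ => Measure.pi fun _ => ν)) ∧
    ∫ ω : (ι → κ → ℝ) × (ι → κ → ℝ), ∏ s, ∏ j, φ s j (ω.1 s j) (ω.2 s j)
      ∂((Measure.pi fun _ => Measure.pi fun _ => ν).prod
        (Measure.pi fun _ => Measure.pi fun _ => ν)) =
      ∏ s, ∏ j, ∫ x, ∫ y, φ s j x y ∂ν ∂ν := by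
  have hI : Integrable
      (fun ω : (ι → κ → ℝ) × (ι → κ → ℝ) => ∏ s, ∏ j, φ s j (ω.1 s j) (ω.2 s j))
      ((Measure.pi fun _ => Measure.pi fun _ => ν).prod
        (Measure.pi fun _ => Measure.pi fun _ => ν)) := by
    refine Integrable.of_bound (C := 1) (Measurable.aestronglyMeasurable ?_)
      (.of_forall fun ω => ?_)
    · refine Finset.measurable_prod _ fun s _ => Finset.measurable_prod _ fun j _ => ?_
      exact (hm s j).comp (f := fun ω : (ι → κ → ℝ) × (ι → κ → ℝ) => (ω.1 s j, ω.2 s j))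
        (by fun_prop)
    · rw [Real.norm_eq_abs, Finset.abs_prod]
      refine Finset.prod_le_one (fun _ _ => abs_nonneg _) fun s _ => ?_
      rw [Finset.abs_prod]
      exact Finset.prod_le_one (fun _ _ => abs_nonneg _) fun j _ => hb s j _ _
  refine ⟨hI, ?_⟩
  have key : ∀ ψ : ι → κ → ℝ → ℝ,
      ∫ z : ι → κ → ℝ, ∏ s, ∏ j, ψ s j (z s j) ∂(Measure.pi fun _ => Measure.pi fun _ => ν) =
        ∏ s, ∏ j, ∫ x, ψ s j x ∂ν := fun ψ => by
    rw [integral_fintype_prod_eq_prod (fun s (z : κ → ℝ) => ∏ j, ψ s j (z j))]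
    exact Finset.prod_congr rfl fun s _ => integral_fintype_prod_eq_prod (fun j => ψ s j)
  rw [integral_prod _ hI]
  exact (integral_congr_ae (.of_forall fun x : ι → κ → ℝ => key fun s j y => φ s j (x s j) y)).trans
    (key fun s j x => ∫ y, φ s j x y ∂ν)

/-- The loss of an action with noise parameter `x`: mean `2/5` if the action is good and
`4/5` otherwise, while the noisy feedback has the same law in both cases. -/
noncomputable def thresholdLoss (good : Bool) (x : ℝ) : Bool :=
  if good then !decide (x < 3 / 5) else decide (x < 4 / 5)

/-- The noisy feedback for noise parameter `x` and seed `y`. -/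
noncomputable def thresholdFeedback (good : Bool) (x y : ℝ) : Bool :=
  Bool.xor (thresholdLoss good x) (decide (y < (1 - x) / 2))

theorem measurable_decide_lt {α : Type*} [MeasurableSpace α] {f g : α → ℝ}
    (hf : Measurable f) (hg : Measurable g) : Measurable fun a => decide (f a < g a) := by
  refine measurable_to_bool ?_
  simpa [Set.preimage] using measurableSet_lt hf hg

theorem measurable_thresholdLoss (good : Bool) : Measurable (thresholdLoss good) := by
  cases good
  · exact measurable_decide_lt measurable_id (measurable_const (a := (4 / 5 : ℝ)))
  · exact (measurable_of_countable not).comp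
      (measurable_decide_lt measurable_id (measurable_const (a := (3 / 5 : ℝ))))

theorem measurable_thresholdFeedback (good : Bool) :
    Measurable fun p : ℝ × ℝ => thresholdFeedback good p.1 p.2 :=
  (measurable_of_countable fun b : Bool × Bool => Bool.xor b.1 b.2).comp
    (((measurable_thresholdLoss good).comp measurable_fst).prodMk
      (measurable_decide_lt measurable_snd (by fun_prop)))

theorem measurable_b2r : Measurable b2r := measurable_of_countable _

theorem abs_b2r_le_one (b : Bool) : |b2r b| ≤ 1 := by cases b <;> simp [b2r]

theorem integral_thresholdLoss (good : Bool) :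
    ∫ x, b2r (thresholdLoss good x) ∂uniform01 = if good then 2 / 5 else 4 / 5 := by
  cases good
  · have := integral_uniform01_ite_lt (a := 4 / 5) (by norm_num) (by norm_num)
      (continuous_const (y := (1 : ℝ))) (continuous_const (y := (0 : ℝ)))
    simpa [thresholdLoss, b2r] using this
  · have := integral_uniform01_ite_lt (a := 3 / 5) (by norm_num) (by norm_num)
      (continuous_const (y := (0 : ℝ))) (continuous_const (y := (1 : ℝ)))
    norm_num at this
    simpa [thresholdLoss, b2r, ← not_lt] using this

theorem integral_b2r_xor_seed (b : Bool) {x : ℝ} (h0 : 0 ≤ x) (h1 : x ≤ 1) :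
    ∫ y, b2r (Bool.xor b (decide (y < (1 - x) / 2))) ∂uniform01 =
      if b then (1 + x) / 2 else (1 - x) / 2 := by
  have ha : 0 ≤ (1 - x) / 2 := by linarith
  have hb : (1 - x) / 2 ≤ 1 := by linarith
  cases b
  · have := integral_uniform01_ite_lt ha hb
      (continuous_const (y := (1 : ℝ))) (continuous_const (y := (0 : ℝ)))
    simpa [b2r] using this
  · have := integral_uniform01_ite_lt ha hb
      (continuous_const (y := (0 : ℝ))) (continuous_const (y := (1 : ℝ)))
    have e : ∀ y : ℝ, b2r (Bool.xor true (decide (y < (1 - x) / 2))) =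
        if y < (1 - x) / 2 then 0 else 1 := fun y => by
      by_cases h : y < (1 - x) / 2 <;> simp [b2r, h]
    simp only [e, this]
    simp
    ring

theorem ae_mem_uniform01 : ∀ᵐ x ∂uniform01, x ∈ Set.Icc (0 : ℝ) 1 :=
  ae_restrict_mem measurableSet_Icc

theorem integral_thresholdFeedback (good : Bool) :
    ∫ x, ∫ y, b2r (thresholdFeedback good x y) ∂uniform01 ∂uniform01 = 57 / 100 := by
  have e : ∫ x, ∫ y, b2r (thresholdFeedback good x y) ∂uniform01 ∂uniform01 =
      ∫ x, (if thresholdLoss good x then (1 + x) / 2 else (1 - x) / 2) ∂uniform01 := by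
    refine integral_congr_ae ?_
    filter_upwards [ae_mem_uniform01] with x hx
    exact integral_b2r_xor_seed _ hx.1 hx.2
  have hp : Continuous fun x : ℝ => (1 + x) / 2 := by fun_prop
  have hq : Continuous fun x : ℝ => (1 - x) / 2 := by fun_prop
  have ip : ∀ a b : ℝ, ∫ x in a..b, (1 + x) / 2 = (b + b ^ 2 / 2 - a - a ^ 2 / 2) / 2 := by
    intro a b
    rw [intervalIntegral.integral_div, intervalIntegral.integral_add (by simp) (by simp)]
    simp
    ring
  have iq : ∀ a b : ℝ, ∫ x in a..b, (1 - x) / 2 = (b - b ^ 2 / 2 - a + a ^ 2 / 2) / 2 := by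
    intro a b
    rw [intervalIntegral.integral_div, intervalIntegral.integral_sub (by simp) (by simp)]
    simp
    ring
  rw [e]
  cases good
  · have := integral_uniform01_ite_lt (a := 4 / 5) (by norm_num) (by norm_num) hp hq
    rw [ip, iq] at this
    norm_num at this
    simpa [thresholdLoss] using this
  · have := integral_uniform01_ite_lt (a := 3 / 5) (by norm_num) (by norm_num) hq hp
    rw [ip, iq] at this
    norm_num at this
    rw [← this]
    refine integral_congr_ae (.of_forall fun x => ?_)
    by_cases h : x < 3 / 5 <;> simp [thresholdLoss, h]

/-- The law of the noisy feedback. -/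
noncomputable def feedbackWeight (b : Bool) : ℝ := if b then 57 / 100 else 43 / 100

theorem integral_thresholdFeedback_eq (good b : Bool) :
    ∫ x, ∫ y, (if thresholdFeedback good x y = b then (1 : ℝ) else 0) ∂uniform01 ∂uniform01 =
      feedbackWeight b := by
  cases b
  · have hm : Measurable fun p : ℝ × ℝ => b2r (thresholdFeedback good p.1 p.2) :=
      measurable_b2r.comp (measurable_thresholdFeedback good)
    have hI : Integrable (fun p : ℝ × ℝ => b2r (thresholdFeedback good p.1 p.2))
        (uniform01.prod uniform01) :=
      Integrable.of_bound (C := 1) hm.aestronglyMeasurable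
        (.of_forall fun p => abs_b2r_le_one _)
    have e : ∀ x y, (if thresholdFeedback good x y = false then (1 : ℝ) else 0) =
        1 - b2r (thresholdFeedback good x y) := fun x y => by
      cases thresholdFeedback good x y <;> simp [b2r]
    have h := integral_thresholdFeedback good
    rw [← integral_prod (fun p : ℝ × ℝ => b2r (thresholdFeedback good p.1 p.2)) hI] at h
    simp only [e]
    rw [← integral_prod (fun p : ℝ × ℝ => 1 - b2r (thresholdFeedback good p.1 p.2))
      ((integrable_const 1).sub hI), integral_sub (integrable_const 1) hI, h]
    simp [feedbackWeight]
    norm_num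
  · exact (integral_thresholdFeedback good).trans (by simp [feedbackWeight])

/-- Probability that the feedback outside round `t` is `f`, with round `t` frozen to `false`. -/
noncomputable def historyWeight {T : ℕ} (t : Fin T) (f : Fin T → Fin 2 → Bool) : ℝ :=
  ∏ s, ∏ j, if s = t then (if f s j = false then 1 else 0) else feedbackWeight (f s j)

theorem sum_historyWeight {T : ℕ} (t : Fin T) : ∑ f, historyWeight t f = 1 := by
  unfold historyWeight
  rw [← Fintype.prod_sum (fun s (r : Fin 2 → Bool) =>
    ∏ j, if s = t then (if r j = false then (1 : ℝ) else 0) else feedbackWeight (r j))]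
  refine Finset.prod_eq_one fun s _ => ?_
  rw [← Fintype.prod_sum (fun (_ : Fin 2) (b : Bool) =>
    if s = t then (if b = false then (1 : ℝ) else 0) else feedbackWeight b)]
  refine Finset.prod_eq_one fun j _ => ?_
  by_cases h : s = t <;> simp [h, feedbackWeight]
  norm_num

theorem integral_adapted_mul_loss {T : ℕ} (good : Fin 2 → Bool) (t : Fin T) (i : Fin 2)
    (q : (Fin T → Fin 2 → Bool) → ℝ)
    (hq : ∀ f f', (∀ s : Fin T, s < t → f s = f' s) → q f = q f') :
    Integrable (fun ω : (Fin T → Fin 2 → ℝ) × (Fin T → Fin 2 → ℝ) =>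
        q (fun s j => thresholdFeedback (good j) (ω.1 s j) (ω.2 s j)) *
          b2r (thresholdLoss (good i) (ω.1 t i)))
      ((Measure.pi fun _ : Fin T => Measure.pi fun _ : Fin 2 => uniform01).prod
        (Measure.pi fun _ : Fin T => Measure.pi fun _ : Fin 2 => uniform01)) ∧
    ∫ ω : (Fin T → Fin 2 → ℝ) × (Fin T → Fin 2 → ℝ),
        q (fun s j => thresholdFeedback (good j) (ω.1 s j) (ω.2 s j)) *
          b2r (thresholdLoss (good i) (ω.1 t i))
      ∂((Measure.pi fun _ : Fin T => Measure.pi fun _ : Fin 2 => uniform01).prod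
        (Measure.pi fun _ : Fin T => Measure.pi fun _ : Fin 2 => uniform01)) =
      (∑ f, q f * historyWeight t f) * if good i then 2 / 5 else 4 / 5 := by
  let φ : (Fin T → Fin 2 → Bool) → Fin T → Fin 2 → ℝ → ℝ → ℝ := fun f s j x y =>
    if s = t then (if f s j = false then 1 else 0) *
      (if j = i then b2r (thresholdLoss (good j) x) else 1)
    else if thresholdFeedback (good j) x y = f s j then 1 else 0
  have hm : ∀ f s j, Measurable fun p : ℝ × ℝ => φ f s j p.1 p.2 := by
    intro f s j
    by_cases hs : s = t
    · by_cases hj : j = i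
      · simp only [φ, hs, hj, if_true]
        exact (measurable_b2r.comp
          ((measurable_thresholdLoss (good i)).comp measurable_fst)).const_mul _
      · simp [φ, hs, hj]
    · simp only [φ, hs, if_false]
      exact (measurable_of_countable fun b : Bool =>
        if b = f s j then (1 : ℝ) else 0).comp (measurable_thresholdFeedback (good j))
  have hb : ∀ f s j x y, |φ f s j x y| ≤ 1 := by
    intro f s j x y
    have := abs_b2r_le_one (thresholdLoss (good j) x)
    simp only [φ]
    split_ifs <;> simp [this]
  have hφ : ∀ f, ∏ s, ∏ j, ∫ x, ∫ y, φ f s j x y ∂uniform01 ∂uniform01 =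
      historyWeight t f * if good i then 2 / 5 else 4 / 5 := by
    intro f
    have e : ∀ s j, ∫ x, ∫ y, φ f s j x y ∂uniform01 ∂uniform01 =
        (if s = t then (if f s j = false then 1 else 0) else feedbackWeight (f s j)) *
          if s = t then (if j = i then (if good i then 2 / 5 else 4 / 5) else 1) else 1 := by
      intro s j
      by_cases hs : s = t
      · by_cases hj : j = i
        · subst hs hj
          simp only [φ, if_true, integral_const, probReal_univ, one_smul]
          rw [integral_const_mul, integral_thresholdLoss]
        · simp [φ, hs, hj]
      · simp [φ, hs, integral_thresholdFeedback_eq]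
    simp only [e, Finset.prod_mul_distrib, historyWeight]
    congr 1
    rw [Finset.prod_eq_single t (by intro s _ hs; simp [hs]) (by simp)]
    simp
  have expand : ∀ ω : (Fin T → Fin 2 → ℝ) × (Fin T → Fin 2 → ℝ),
      q (fun s j => thresholdFeedback (good j) (ω.1 s j) (ω.2 s j)) *
          b2r (thresholdLoss (good i) (ω.1 t i)) =
        ∑ f, q f * ∏ s, ∏ j, φ f s j (ω.1 s j) (ω.2 s j) := by
    intro ω
    set c : Fin T → Fin 2 → Bool :=
      fun s j => thresholdFeedback (good j) (ω.1 s j) (ω.2 s j) with hc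
    have hqc : q c = q (Function.update c t fun _ => false) :=
      hq _ _ fun s hs => by rw [Function.update_of_ne hs.ne]
    rw [Finset.sum_eq_single (Function.update c t fun _ => false), ← hqc]
    · congr 1
      rw [Finset.prod_eq_single t]
      · simp [φ]
      · intro s _ hs
        simp [φ, hs, hc]
      · simp
    · intro f _ hf
      obtain ⟨s, hs⟩ := Function.ne_iff.1 hf
      obtain ⟨j, hj⟩ := Function.ne_iff.1 hs
      refine mul_eq_zero_of_right _ (Finset.prod_eq_zero (Finset.mem_univ s)
        (Finset.prod_eq_zero (Finset.mem_univ j) ?_))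
      by_cases h : s = t
      · subst h
        simp only [Function.update_self] at hj
        simp [φ, hj]
      · rw [Function.update_of_ne h] at hj
        simp only [φ, if_neg h]
        exact if_neg (Ne.symm hj)
    · simp
  have hI := fun f => integral_prod_pi_pi_prod uniform01 (φ f) (hm f) (hb f)
  simp only [expand]
  refine ⟨integrable_finsetSum _ fun f _ => (hI f).1.const_mul _, ?_⟩
  rw [integral_finsetSum _ fun f _ => (hI f).1.const_mul _, Finset.sum_mul]
  refine Finset.sum_congr rfl fun f _ => ?_
  rw [integral_const_mul, (hI f).2, hφ, mul_assoc]

theorem integral_sum_loss {T : ℕ} (good : Fin 2 → Bool) (k : Fin 2) :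
    ∫ ω : (Fin T → Fin 2 → ℝ) × (Fin T → Fin 2 → ℝ),
        (∑ t, b2r (thresholdLoss (good k) (ω.1 t k)))
      ∂((Measure.pi fun _ : Fin T => Measure.pi fun _ : Fin 2 => uniform01).prod
        (Measure.pi fun _ : Fin T => Measure.pi fun _ : Fin 2 => uniform01)) =
      T * if good k then 2 / 5 else 4 / 5 := by
  have h := fun t : Fin T => integral_adapted_mul_loss good t k (fun _ => 1) fun _ _ _ => rfl
  simp only [one_mul, sum_historyWeight] at h
  rw [integral_finsetSum _ fun t _ => (h t).1]
  simp [fun t => (h t).2]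

/-- with `K = 2` actions and i.i.d. uniform noise parameters that the learner
does NOT observe, every algorithm suffers expected regret at least `T/8` against some loss
strategy (which may depend on the realized noise parameters).  Sample space: `ω.1 t i = ε_{i,t}`
and `ω.2 t i` is a uniform seed generating the Bernoulli((1-ε_{i,t})/2) noise bit.  The
algorithm's distribution at round `t` depends only on the noisy feedbacks of rounds `< t`. -/
theorem full_info_variable_noise_unknown_linear_regret (T : ℕ)
    (alg : Fin T → (Fin T → Fin 2 → Bool) → Fin 2 → ℝ)
    (hadapt : ∀ t f f', (∀ s : Fin T, s < t → f s = f' s) → alg t f = alg t f')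
    (hnonneg : ∀ t f i, 0 ≤ alg t f i)
    (hsum : ∀ t f, ∑ i, alg t f i = 1) :
    ∃ ℓ : (Fin T → Fin 2 → ℝ) → Fin 2 → Fin T → Bool,
      (∀ k t, Measurable fun e => ℓ e k t) ∧
      (T : ℝ) / 8 ≤
        (∫ ω : (Fin T → Fin 2 → ℝ) × (Fin T → Fin 2 → ℝ),
            (∑ t, ∑ i,
              alg t (fun s j => Bool.xor (ℓ ω.1 j s) (decide (ω.2 s j < (1 - ω.1 s j) / 2))) i *
                b2r (ℓ ω.1 i t))
            ∂((Measure.pi fun _ : Fin T => Measure.pi fun _ : Fin 2 => uniform01).prod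
                (Measure.pi fun _ : Fin T => Measure.pi fun _ : Fin 2 => uniform01)))
          - Finset.univ.inf' Finset.univ_nonempty
              (fun k =>
                ∫ ω : (Fin T → Fin 2 → ℝ) × (Fin T → Fin 2 → ℝ),
                  (∑ t, b2r (ℓ ω.1 k t))
                  ∂((Measure.pi fun _ : Fin T => Measure.pi fun _ : Fin 2 => uniform01).prod
                      (Measure.pi fun _ : Fin T => Measure.pi fun _ : Fin 2 => uniform01))) := by
  let Q : Fin T → Fin 2 → ℝ := fun t i => ∑ f, alg t f i * historyWeight t f
  have hQ : ∀ t, Q t 0 + Q t 1 = 1 := fun t => by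
    simp only [Q, ← Finset.sum_add_distrib, ← add_mul]
    have h : ∀ f, alg t f 0 + alg t f 1 = 1 := fun f => by rw [← hsum t f, Fin.sum_univ_two]
    simp only [h, one_mul, sum_historyWeight]
  have hS : ∑ t, Q t 0 + ∑ t, Q t 1 = T := by
    simp [← Finset.sum_add_distrib, hQ]
  obtain ⟨g, hg⟩ : ∃ g : Fin 2, ∑ t, Q t g ≤ T / 2 := by
    by_cases h : ∑ t, Q t 0 ≤ T / 2
    · exact ⟨0, h⟩
    · exact ⟨1, by linarith⟩
  let good : Fin 2 → Bool := fun k => decide (k = g)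
  refine ⟨fun e k t => thresholdLoss (good k) (e t k), fun k t =>
    (measurable_thresholdLoss (good k)).comp (by fun_prop), ?_⟩
  have hL := fun t i => integral_adapted_mul_loss good t i (fun f => alg t f i)
    fun f f' h => by rw [hadapt t f f' h]
  have hlearner := integral_finsetSum (Finset.univ : Finset (Fin T)) fun t _ =>
    integrable_finsetSum (Finset.univ : Finset (Fin 2)) fun i _ => (hL t i).1
  have hrow : ∀ t, ∑ i, Q t i * (if good i then 2 / 5 else 4 / 5) = 4 / 5 - 2 / 5 * Q t g := by
    intro t
    have := hQ t
    rw [Fin.sum_univ_two]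
    fin_cases g <;> simp [good] <;> linarith
  have hbest := Finset.inf'_le (s := Finset.univ) (b := g)
    (fun k => ∫ ω : (Fin T → Fin 2 → ℝ) × (Fin T → Fin 2 → ℝ),
      (∑ t, b2r (thresholdLoss (good k) (ω.1 t k)))
      ∂((Measure.pi fun _ : Fin T => Measure.pi fun _ : Fin 2 => uniform01).prod
        (Measure.pi fun _ : Fin T => Measure.pi fun _ : Fin 2 => uniform01)))
    (Finset.mem_univ g)
  rw [integral_sum_loss] at hbest
  have hgood : good g = true := by simp [good]
  rw [hgood, if_pos rfl] at hbest
  have hvalue := hlearner.trans (Finset.sum_congr rfl fun t _ =>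
    (integral_finsetSum _ fun i _ => (hL t i).1).trans
      ((Finset.sum_congr rfl fun i _ => (hL t i).2).trans (hrow t)))
  rw [Finset.sum_sub_distrib, ← Finset.mul_sum, Finset.sum_const, Finset.card_univ,
    Fintype.card_fin, nsmul_eq_mul] at hvalue
  have hT : (0 : ℝ) ≤ T := Nat.cast_nonneg T
  refine le_trans ?_ (sub_le_sub hvalue.ge hbest)
  linarith
end
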